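/- Let η : ℝ×ℝ³ → ℝ³ and q : ℝ×ℝ³ → ℝ be C^∞, satisfying the equivariance/periodicity conditions η(t, x+(k₁,k₂,0)) = η(t,x) + (k₁,k₂,0) and q(t, x+(k₁,k₂,0)) = q(t,x) for all k₁,k₂ ∈ ℤ. Set v = ∂_tη, let a be the cofactor matrix of ∇η, and assume the Lagrangian Euler equation ∂_tv_α + a^{μα}∂_μq = 0 holds on ℝ×ℝ³ as well as the rigid-bottom condition η³(t, x₁, x₂, 0) = 0 for all t, x₁, x₂. Let Ω = [0,1]²×[0,1] and Γ₁ = [0,1]²×{1}. Then for every t the map s ↦ (1/2)∫_Ω |∂_t²v(s,x)|² dx is differentiable at t with derivative (d/dt)(1/2)∫_Ω |∂_t²v|² dx = ∫_Ω ∂_t²(a^{μα}q) ∂_t²∂_μ v_α dx − ∫_{[0,1]²} (∂_t²(a^{3α}q) ∂_t²v_α)(t, x₁, x₂, 1) dx₁dx₂; in particular the boundary contribution from the bottom face x₃ = 0 vanishes. -/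

import Mathlib

open MeasureTheory

noncomputable section

/-- The Levi-Civita symbol `ε` on three indices (indices `0,1,2` stand for `1,2,3`). -/
def eps (i j k : Fin 3) : ℝ :=
  if (i, j, k) = ((0 : Fin 3), (1 : Fin 3), (2 : Fin 3)) ∨ (i, j, k) = (1, 2, 0) ∨
      (i, j, k) = (2, 0, 1) then 1
  else if (i, j, k) = ((0 : Fin 3), (2 : Fin 3), (1 : Fin 3)) ∨ (i, j, k) = (2, 1, 0) ∨
      (i, j, k) = (1, 0, 2) then -1
  else 0

/-- Time derivative `∂_t` of a scalar field on `ℝ × ℝ³`. -/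
def Dt (f : ℝ × (Fin 3 → ℝ) → ℝ) : ℝ × (Fin 3 → ℝ) → ℝ :=
  fun p => deriv (fun s => f (s, p.2)) p.1

/-- Spatial partial derivative `∂_μ` of a scalar field on `ℝ × ℝ³`
(`μ = 0,1,2` standing for `1,2,3`). -/
def Dx (μ : Fin 3) (f : ℝ × (Fin 3 → ℝ) → ℝ) : ℝ × (Fin 3 → ℝ) → ℝ :=
  fun p => fderiv ℝ (fun y => f (p.1, y)) p.2 (Pi.single μ 1)

/-- The cofactor matrix `a` of `∇η`: `a^{1α} = ε^{αλτ}∂₂η_λ∂₃η_τ`,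
`a^{2α} = −ε^{αλτ}∂₁η_λ∂₃η_τ`, `a^{3α} = ε^{αλτ}∂₁η_λ∂₂η_τ`. -/
def cof (η : ℝ × (Fin 3 → ℝ) → Fin 3 → ℝ) (μ α : Fin 3) : ℝ × (Fin 3 → ℝ) → ℝ :=
  fun p =>
    if μ = 0 then
      ∑ lam : Fin 3, ∑ τ : Fin 3,
        eps α lam τ * Dx 1 (fun r => η r lam) p * Dx 2 (fun r => η r τ) p
    else if μ = 1 then
      - ∑ lam : Fin 3, ∑ τ : Fin 3,
        eps α lam τ * Dx 0 (fun r => η r lam) p * Dx 2 (fun r => η r τ) p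
    else
      ∑ lam : Fin 3, ∑ τ : Fin 3,
        eps α lam τ * Dx 0 (fun r => η r lam) p * Dx 1 (fun r => η r τ) p

theorem Dt_eq_fderiv {f : ℝ × (Fin 3 → ℝ) → ℝ} (hf : Differentiable ℝ f) :
    Dt f = fun p => fderiv ℝ f p (1, 0) := by
  funext p
  exact ((hf p).hasFDerivAt.comp_hasDerivAt p.1
    ((hasDerivAt_id p.1).prodMk (hasDerivAt_const p.1 p.2))).deriv

theorem Dx_eq_fderiv (μ : Fin 3) {f : ℝ × (Fin 3 → ℝ) → ℝ} (hf : Differentiable ℝ f) :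
    Dx μ f = fun p => fderiv ℝ f p (0, Pi.single μ 1) := by
  funext p
  have h : HasFDerivAt (fun y => f (p.1, y)) _ p.2 :=
    (hf p).hasFDerivAt.comp p.2 (hasFDerivAt_prodMk_right p.1 p.2)
  simp [Dx, h.fderiv]

theorem contDiff_fderiv_const_apply {f : ℝ × (Fin 3 → ℝ) → ℝ} (hf : ContDiff ℝ (⊤ : ℕ∞) f)
    (u : ℝ × (Fin 3 → ℝ)) : ContDiff ℝ (⊤ : ℕ∞) (fun p => fderiv ℝ f p u) :=
  (hf.fderiv_right (m := (⊤ : ℕ∞)) (by simp)).clm_apply contDiff_const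

theorem contDiff_Dt {f : ℝ × (Fin 3 → ℝ) → ℝ} (hf : ContDiff ℝ (⊤ : ℕ∞) f) :
    ContDiff ℝ (⊤ : ℕ∞) (Dt f) := by
  rw [Dt_eq_fderiv (hf.differentiable (by simp))]
  exact contDiff_fderiv_const_apply hf _

theorem contDiff_Dx (μ : Fin 3) {f : ℝ × (Fin 3 → ℝ) → ℝ} (hf : ContDiff ℝ (⊤ : ℕ∞) f) :
    ContDiff ℝ (⊤ : ℕ∞) (Dx μ f) := by
  rw [Dx_eq_fderiv μ (hf.differentiable (by simp))]
  exact contDiff_fderiv_const_apply hf _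

theorem fderiv_fderiv_apply_comm {f : ℝ × (Fin 3 → ℝ) → ℝ} (hf : ContDiff ℝ (⊤ : ℕ∞) f)
    (u w p : ℝ × (Fin 3 → ℝ)) :
    fderiv ℝ (fun r => fderiv ℝ f r u) p w = fderiv ℝ (fun r => fderiv ℝ f r w) p u := by
  have hd : DifferentiableAt ℝ (fderiv ℝ f) p :=
    (hf.fderiv_right (m := (⊤ : ℕ∞)) (by simp)).differentiable (by simp) p
  have hs : IsSymmSndFDerivAt ℝ f p := hf.contDiffAt.isSymmSndFDerivAt (by
    rw [minSmoothness_of_isRCLikeNormedField]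
    exact WithTop.coe_le_coe.2 le_top)
  rw [fderiv_clm_apply hd (differentiableAt_const u), fderiv_clm_apply hd (differentiableAt_const w)]
  simpa using hs.eq w u

theorem Dt_Dx_comm (μ : Fin 3) {f : ℝ × (Fin 3 → ℝ) → ℝ} (hf : ContDiff ℝ (⊤ : ℕ∞) f) :
    Dt (Dx μ f) = Dx μ (Dt f) := by
  rw [Dt_eq_fderiv ((contDiff_Dx μ hf).differentiable (by simp)),
    Dx_eq_fderiv μ ((contDiff_Dt hf).differentiable (by simp)),
    Dx_eq_fderiv μ (hf.differentiable (by simp)), Dt_eq_fderiv (hf.differentiable (by simp))]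
  exact funext fun p => fderiv_fderiv_apply_comm hf _ _ p

theorem Dx_Dx_comm (μ ν : Fin 3) {f : ℝ × (Fin 3 → ℝ) → ℝ} (hf : ContDiff ℝ (⊤ : ℕ∞) f) :
    Dx μ (Dx ν f) = Dx ν (Dx μ f) := by
  rw [Dx_eq_fderiv μ ((contDiff_Dx ν hf).differentiable (by simp)),
    Dx_eq_fderiv ν ((contDiff_Dx μ hf).differentiable (by simp)),
    Dx_eq_fderiv μ (hf.differentiable (by simp)), Dx_eq_fderiv ν (hf.differentiable (by simp))]
  exact funext fun p => fderiv_fderiv_apply_comm hf _ _ p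

theorem Dt_neg_sum {ι : Type*} [Fintype ι] {f : ι → ℝ × (Fin 3 → ℝ) → ℝ}
    (hf : ∀ i, ContDiff ℝ (⊤ : ℕ∞) (f i)) :
    Dt (fun r => -∑ i, f i r) = fun r => -∑ i, Dt (f i) r := by
  have hd := fun i => (hf i).differentiable (by simp)
  rw [Dt_eq_fderiv (.fun_neg (.fun_sum fun i _ => hd i))]
  funext p
  rw [fderiv_fun_neg, fderiv_fun_sum fun i _ => hd i p]
  simp [Dt_eq_fderiv (hd _)]

theorem Dx_sum (μ : Fin 3) {ι : Type*} [Fintype ι] {f : ι → ℝ × (Fin 3 → ℝ) → ℝ}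
    (hf : ∀ i, ContDiff ℝ (⊤ : ℕ∞) (f i)) (p : ℝ × (Fin 3 → ℝ)) :
    Dx μ (fun r => ∑ i, f i r) p = ∑ i, Dx μ (f i) p := by
  have hd := fun i => (hf i).differentiable (by simp)
  rw [Dx_eq_fderiv μ (.fun_sum fun i _ => hd i)]
  simp only
  rw [fderiv_fun_sum fun i _ => hd i p]
  simp [Dx_eq_fderiv μ (hd _)]

theorem Dx_neg (μ : Fin 3) (f : ℝ × (Fin 3 → ℝ) → ℝ) (p : ℝ × (Fin 3 → ℝ)) :
    Dx μ (fun r => -f r) p = -Dx μ f p := by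
  simp [Dx, fderiv_fun_neg]

theorem Dx_mul (μ : Fin 3) {f g : ℝ × (Fin 3 → ℝ) → ℝ} (hf : ContDiff ℝ (⊤ : ℕ∞) f)
    (hg : ContDiff ℝ (⊤ : ℕ∞) g) (p : ℝ × (Fin 3 → ℝ)) :
    Dx μ (fun r => f r * g r) p = Dx μ f p * g p + f p * Dx μ g p := by
  have hf' := hf.differentiable (by simp)
  have hg' := hg.differentiable (by simp)
  rw [Dx_eq_fderiv μ (hf'.fun_mul hg'), Dx_eq_fderiv μ hf', Dx_eq_fderiv μ hg']
  simp only
  rw [fderiv_fun_mul (hf' p) (hg' p)]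
  simp
  ring

theorem contDiff_cof {η : ℝ × (Fin 3 → ℝ) → Fin 3 → ℝ}
    (hη : ∀ i, ContDiff ℝ (⊤ : ℕ∞) (fun r => η r i)) (μ α : Fin 3) :
    ContDiff ℝ (⊤ : ℕ∞) (cof η μ α) := by
  have h : ∀ ν i, ContDiff ℝ (⊤ : ℕ∞) (Dx ν (fun r => η r i)) := fun ν i => contDiff_Dx ν (hη i)
  unfold cof
  split_ifs
  · exact .sum fun i _ => .sum fun j _ => (contDiff_const.mul (h _ _)).mul (h _ _)
  · exact (ContDiff.sum fun i _ => .sum fun j _ => (contDiff_const.mul (h _ _)).mul (h _ _)).neg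
  · exact .sum fun i _ => .sum fun j _ => (contDiff_const.mul (h _ _)).mul (h _ _)

/-- The Piola identity `∂_μ a^{μα} = 0`. -/
theorem sum_Dx_cof {η : ℝ × (Fin 3 → ℝ) → Fin 3 → ℝ}
    (hη : ∀ i, ContDiff ℝ (⊤ : ℕ∞) (fun r => η r i)) (α : Fin 3) (p : ℝ × (Fin 3 → ℝ)) :
    ∑ μ : Fin 3, Dx μ (cof η μ α) p = 0 := by
  have h : ∀ ν i, ContDiff ℝ (⊤ : ℕ∞) (Dx ν (fun r => η r i)) := fun ν i => contDiff_Dx ν (hη i)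
  have hmul : ∀ (c : ℝ) (μ ν ρ i j : Fin 3),
      Dx μ (fun r => c * Dx ν (fun r => η r i) r * Dx ρ (fun r => η r j) r) p =
        c * (Dx μ (Dx ν (fun r => η r i)) p * Dx ρ (fun r => η r j) p
          + Dx ν (fun r => η r i) p * Dx μ (Dx ρ (fun r => η r j)) p) := by
    intro c μ ν ρ i j
    rw [Dx_mul μ (contDiff_const.mul (h ν i)) (h ρ j), Dx_mul μ contDiff_const (h ν i)]
    simp only [Dx, fderiv_fun_const, Pi.zero_apply, zero_apply]
    ring
  have hsum : ∀ μ ν ρ : Fin 3,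
      Dx μ (fun r => ∑ i : Fin 3, ∑ j : Fin 3,
        eps α i j * Dx ν (fun r => η r i) r * Dx ρ (fun r => η r j) r) p =
      ∑ i : Fin 3, ∑ j : Fin 3, eps α i j *
        (Dx μ (Dx ν (fun r => η r i)) p * Dx ρ (fun r => η r j) p
          + Dx ν (fun r => η r i) p * Dx μ (Dx ρ (fun r => η r j)) p) := by
    intro μ ν ρ
    rw [Dx_sum μ fun i => .sum fun j _ => (contDiff_const.mul (h _ _)).mul (h _ _)]
    refine Finset.sum_congr rfl fun i _ => ?_
    rw [Dx_sum μ fun j => (contDiff_const.mul (h _ _)).mul (h _ _)]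
    exact Finset.sum_congr rfl fun j _ => hmul _ _ _ _ _ _
  have e0 : Dx 0 (cof η 0 α) p = _ := hsum 0 1 2
  have e1 : Dx 1 (cof η 1 α) p = _ := (Dx_neg 1 _ p).trans (congrArg Neg.neg (hsum 1 0 2))
  have e2 : Dx 2 (cof η 2 α) p = _ := hsum 2 0 1
  rw [Fin.sum_univ_three, e0, e1, e2]
  simp only [Dx_Dx_comm 1 0 (hη _), Dx_Dx_comm 2 0 (hη _), Dx_Dx_comm 2 1 (hη _)]
  fin_cases α <;> simp [Fin.sum_univ_three, eps] <;> ring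

theorem Dt_periodic {f : ℝ × (Fin 3 → ℝ) → ℝ} {k : Fin 3 → ℝ}
    (hf : ∀ t x, f (t, x + k) = f (t, x)) (t : ℝ) (x : Fin 3 → ℝ) :
    Dt f (t, x + k) = Dt f (t, x) := by
  simp only [Dt, hf]

theorem Dx_periodic (μ : Fin 3) {f : ℝ × (Fin 3 → ℝ) → ℝ} {k : Fin 3 → ℝ} {c : ℝ}
    (hf : ∀ t x, f (t, x + k) = f (t, x) + c) (t : ℝ) (x : Fin 3 → ℝ) :
    Dx μ f (t, x + k) = Dx μ f (t, x) := by
  simp only [Dx]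
  rw [← fderiv_comp_add_right (f := fun y => f (t, y)) k]
  simp only [hf, fderiv_add_const]

theorem Dt_eq_zero_of_bottom {f : ℝ × (Fin 3 → ℝ) → ℝ}
    (hf : ∀ t x, x 2 = 0 → f (t, x) = 0) (t : ℝ) (x : Fin 3 → ℝ) (hx : x 2 = 0) :
    Dt f (t, x) = 0 := by
  simp [Dt, hf _ x hx]

theorem Dx_eq_zero_of_bottom {μ : Fin 3} (hμ : μ ≠ 2) {f : ℝ × (Fin 3 → ℝ) → ℝ}
    (hd : ContDiff ℝ (⊤ : ℕ∞) f)
    (hf : ∀ t x, x 2 = 0 → f (t, x) = 0) (t : ℝ) (x : Fin 3 → ℝ) (hx : x 2 = 0) :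
    Dx μ f (t, x) = 0 := by
  rw [Dx_eq_fderiv μ (hd.differentiable (by simp))]
  simp only
  rw [← (hd.differentiable (by simp) (t, x)).lineDeriv_eq_fderiv, lineDeriv]
  have : (fun s : ℝ => f ((t, x) + s • ((0 : ℝ), (Pi.single μ 1 : Fin 3 → ℝ)))) = fun _ => 0 := by
    funext s
    exact hf _ _ (by simp [hx, hμ.symm])
  rw [this, deriv_const]

theorem hasDerivAt_setIntegral_Icc {g : ℝ × (Fin 3 → ℝ) → ℝ} (hg : ContDiff ℝ (⊤ : ℕ∞) g)
    (a b : Fin 3 → ℝ) (t : ℝ) :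
    HasDerivAt (fun s => ∫ x in Set.Icc a b, g (s, x))
      (∫ x in Set.Icc a b, Dt g (t, x)) t := by
  have hcont := (contDiff_Dt hg).continuous
  obtain ⟨C, hC⟩ := ((isCompact_closedBall t 1).prod
    (isCompact_Icc (a := a) (b := b))).exists_bound_of_continuousOn hcont.continuousOn
  have hint : ∀ {h : ℝ × (Fin 3 → ℝ) → ℝ}, Continuous h → ∀ s,
      IntegrableOn (fun x => h (s, x)) (Set.Icc a b) := fun hh s =>
    (hh.comp (Continuous.prodMk_right s)).continuousOn.integrableOn_compact isCompact_Icc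
  refine (hasDerivAt_integral_of_dominated_loc_of_deriv_le (μ := volume.restrict (Set.Icc a b))
    (F := fun s x => g (s, x)) (F' := fun s x => Dt g (s, x)) (bound := fun _ => C)
    (Metric.ball_mem_nhds t one_pos)
    (Filter.Eventually.of_forall fun s => (hint hg.continuous s).aestronglyMeasurable)
    (hint hg.continuous t) (hint hcont t).aestronglyMeasurable ?_ ?_ ?_).2
  · filter_upwards [ae_restrict_mem measurableSet_Icc] with x hx s hs
    exact hC _ ⟨Metric.ball_subset_closedBall hs, hx⟩
  · exact (continuous_const.continuousOn.integrableOn_compact isCompact_Icc)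
  · refine Filter.Eventually.of_forall fun x s _ => ?_
    exact ((hg.differentiable (by simp) (s, x)).comp s
      (differentiableAt_id.prodMk (differentiableAt_const x))).hasDerivAt

/-- The divergence theorem on the unit box for a field that is periodic in the first two
variables. -/
theorem integral_sum_Dx_of_periodic {F : Fin 3 → ℝ × (Fin 3 → ℝ) → ℝ}
    (hF : ∀ μ, ContDiff ℝ (⊤ : ℕ∞) (F μ))
    (hper : ∀ (μ : Fin 3) (t : ℝ) (x : Fin 3 → ℝ) (k₁ k₂ : ℤ),
      F μ (t, x + ![(k₁ : ℝ), (k₂ : ℝ), 0]) = F μ (t, x)) (t : ℝ) :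
    ∫ x in Set.Icc (0 : Fin 3 → ℝ) 1, ∑ μ : Fin 3, Dx μ (F μ) (t, x) =
      (∫ y in Set.Icc (0 : Fin 2 → ℝ) 1, F 2 (t, ![y 0, y 1, 1]))
        - ∫ y in Set.Icc (0 : Fin 2 → ℝ) 1, F 2 (t, ![y 0, y 1, 0]) := by
  have hd : ∀ μ, Differentiable ℝ (fun y => F μ (t, y)) := fun μ =>
    ((hF μ).differentiable (by simp)).comp
      ((differentiable_const t).prodMk differentiable_id)
  have key := integral_divergence_of_hasFDerivAt_off_countable (n := 2) (0 : Fin 3 → ℝ) 1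
    zero_le_one (fun x μ => F μ (t, x))
    (fun x => ContinuousLinearMap.pi fun μ => fderiv ℝ (fun y => F μ (t, y)) x) ∅
    Set.countable_empty
    (continuous_pi fun μ => (hd μ).continuous).continuousOn
    (fun x _ => hasFDerivAt_pi.2 fun μ => (hd μ x).hasFDerivAt)
    ((continuous_finsetSum _ fun μ _ =>
      (contDiff_Dx μ (hF μ)).continuous.comp
        (Continuous.prodMk_right t)).continuousOn.integrableOn_compact isCompact_Icc)
  have e0 : ∀ (c : ℝ) (y : Fin 2 → ℝ), (0 : Fin 3).insertNth c y = ![c, y 0, y 1] := by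
    intro c y
    funext i
    fin_cases i <;> rfl
  have e1 : ∀ (c : ℝ) (y : Fin 2 → ℝ), (1 : Fin 3).insertNth c y = ![y 0, c, y 1] := by
    intro c y
    funext i
    fin_cases i <;> rfl
  have e2 : ∀ (c : ℝ) (y : Fin 2 → ℝ), (2 : Fin 3).insertNth c y = ![y 0, y 1, c] := by
    intro c y
    funext i
    fin_cases i <;> rfl
  have h0 : ∀ b c : ℝ, F 0 (t, ![1, b, c]) = F 0 (t, ![0, b, c]) := fun b c => by
    simpa using hper 0 t ![0, b, c] 1 0
  have h1 : ∀ b c : ℝ, F 1 (t, ![b, 1, c]) = F 1 (t, ![b, 0, c]) := fun b c => by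
    simpa using hper 1 t ![b, 0, c] 0 1
  refine key.trans ((Fin.sum_univ_three _).trans ?_)
  simp only [Pi.zero_apply, Pi.one_apply, e0, e1, e2, h0, h1, sub_self, zero_add]
  rfl

theorem half_Dt_sum_sq {w : Fin 3 → ℝ × (Fin 3 → ℝ) → ℝ}
    {G : Fin 3 → Fin 3 → ℝ × (Fin 3 → ℝ) → ℝ}
    (hw : ∀ α, ContDiff ℝ (⊤ : ℕ∞) (w α)) (hG : ∀ μ α, ContDiff ℝ (⊤ : ℕ∞) (G μ α))
    (hwG : ∀ α p, Dt (w α) p = -∑ μ : Fin 3, Dx μ (G μ α) p) (p : ℝ × (Fin 3 → ℝ)) :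
    (1 / 2 : ℝ) * Dt (fun r => ∑ α : Fin 3, (w α r) ^ 2) p =
      (∑ μ : Fin 3, ∑ α : Fin 3, G μ α p * Dx μ (w α) p)
        - ∑ μ : Fin 3, Dx μ (fun r => ∑ α : Fin 3, G μ α r * w α r) p := by
  have hderiv : ∀ α, HasDerivAt (fun s => w α (s, p.2)) (Dt (w α) p) p.1 := fun α =>
    (((hw α).differentiable (by simp) p).comp p.1
      (differentiableAt_id.prodMk (differentiableAt_const p.2))).hasDerivAt
  have hsq : Dt (fun r => ∑ α : Fin 3, (w α r) ^ 2) p = _ :=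
    (HasDerivAt.fun_sum fun α (_ : α ∈ Finset.univ) => (hderiv α).fun_pow 2).deriv
  have hdx : ∀ μ, Dx μ (fun r => ∑ α : Fin 3, G μ α r * w α r) p =
      ∑ α : Fin 3, (Dx μ (G μ α) p * w α p + G μ α p * Dx μ (w α) p) := by
    intro μ
    rw [Dx_sum μ fun α => (hG μ α).mul (hw α)]
    exact Finset.sum_congr rfl fun α _ => Dx_mul μ (hG μ α) (hw α) p
  rw [hsq]
  simp only [hdx, hwG]
  simp only [Fin.sum_univ_three]
  norm_num
  ring

/-- Energy identity for `∂_t²v` on the periodic channel `Ω = [0,1]²×[0,1]` with rigid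
bottom: the energy `(1/2)∫_Ω |∂_t²v|²` is differentiable in time with derivative
`∫_Ω ∂_t²(a^{μα}q) ∂_t²∂_μv_α − ∫_{Γ₁} ∂_t²(a^{3α}q) ∂_t²v_α`, and the boundary
contribution from the bottom face `x₃ = 0` vanishes. -/
theorem tangential_energy_identity
    (η : ℝ × (Fin 3 → ℝ) → Fin 3 → ℝ) (q : ℝ × (Fin 3 → ℝ) → ℝ)
    (hη : ContDiff ℝ (⊤ : ℕ∞) η) (hq : ContDiff ℝ (⊤ : ℕ∞) q)
    (hηper : ∀ (t : ℝ) (x : Fin 3 → ℝ) (k₁ k₂ : ℤ),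
      η (t, x + ![(k₁ : ℝ), (k₂ : ℝ), 0]) = η (t, x) + ![(k₁ : ℝ), (k₂ : ℝ), 0])
    (hqper : ∀ (t : ℝ) (x : Fin 3 → ℝ) (k₁ k₂ : ℤ),
      q (t, x + ![(k₁ : ℝ), (k₂ : ℝ), 0]) = q (t, x))
    (v : ℝ × (Fin 3 → ℝ) → Fin 3 → ℝ)
    (hv : ∀ (p : ℝ × (Fin 3 → ℝ)) (α : Fin 3), v p α = Dt (fun r => η r α) p)
    (a : Fin 3 → Fin 3 → ℝ × (Fin 3 → ℝ) → ℝ) (ha : ∀ μ α, a μ α = cof η μ α)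
    (heuler : ∀ (p : ℝ × (Fin 3 → ℝ)) (α : Fin 3),
      Dt (fun r => v r α) p + ∑ μ : Fin 3, a μ α p * Dx μ q p = 0)
    (hbottom : ∀ t x₁ x₂ : ℝ, η (t, ![x₁, x₂, 0]) 2 = 0) :
    ∀ t : ℝ,
      HasDerivAt
        (fun s => (1/2 : ℝ) * ∫ x in Set.Icc (0 : Fin 3 → ℝ) 1,
          ∑ α : Fin 3, (Dt (Dt (fun r => v r α)) (s, x))^2)
        ((∫ x in Set.Icc (0 : Fin 3 → ℝ) 1, ∑ μ : Fin 3, ∑ α : Fin 3,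
            Dt (Dt (fun r => a μ α r * q r)) (t, x) * Dt (Dt (Dx μ (fun r => v r α))) (t, x))
          - ∫ y in Set.Icc (0 : Fin 2 → ℝ) 1, ∑ α : Fin 3,
              Dt (Dt (fun r => a 2 α r * q r)) (t, ![y 0, y 1, 1])
                * Dt (Dt (fun r => v r α)) (t, ![y 0, y 1, 1]))
        t
      ∧ (∫ y in Set.Icc (0 : Fin 2 → ℝ) 1, ∑ α : Fin 3,
          Dt (Dt (fun r => a 2 α r * q r)) (t, ![y 0, y 1, 0])
            * Dt (Dt (fun r => v r α)) (t, ![y 0, y 1, 0])) = 0 := by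
  intro t
  have hηi : ∀ i, ContDiff ℝ (⊤ : ℕ∞) (fun r => η r i) := contDiff_pi.1 hη
  obtain rfl : a = cof η := funext fun μ => funext fun α => ha μ α
  have hv' : ∀ α, (fun r => v r α) = Dt (fun r => η r α) := fun α => funext fun p => hv p α
  have hvs : ∀ α, ContDiff ℝ (⊤ : ℕ∞) (fun r => v r α) := fun α => hv' α ▸ contDiff_Dt (hηi α)
  have hws : ∀ α, ContDiff ℝ (⊤ : ℕ∞) (Dt (Dt (fun r => v r α))) := fun α =>
    contDiff_Dt (contDiff_Dt (hvs α))
  have hcs : ∀ μ α, ContDiff ℝ (⊤ : ℕ∞) (cof η μ α) := contDiff_cof hηi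
  have haq : ∀ μ α, ContDiff ℝ (⊤ : ℕ∞) (fun r => cof η μ α r * q r) := fun μ α =>
    (hcs μ α).mul hq
  have hGs : ∀ μ α, ContDiff ℝ (⊤ : ℕ∞) (Dt (Dt (fun r => cof η μ α r * q r))) := fun μ α =>
    contDiff_Dt (contDiff_Dt (haq μ α))
  have hdiv : ∀ α, Dt (fun r => v r α) =
      fun p => -∑ μ : Fin 3, Dx μ (fun r => cof η μ α r * q r) p := by
    intro α
    funext p
    simp only [Dx_mul _ (hcs _ α) hq, Finset.sum_add_distrib, ← Finset.sum_mul,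
      sum_Dx_cof hηi α p]
    linarith [heuler p α]
  have hdiv3 : ∀ α, Dt (Dt (Dt (fun r => v r α))) =
      fun p => -∑ μ : Fin 3, Dx μ (Dt (Dt (fun r => cof η μ α r * q r))) p := by
    intro α
    rw [hdiv α, Dt_neg_sum fun μ => contDiff_Dx μ (haq μ α)]
    simp only [Dt_Dx_comm _ (haq _ α)]
    rw [Dt_neg_sum fun μ => contDiff_Dx μ (contDiff_Dt (haq μ α))]
    simp only [Dt_Dx_comm _ (contDiff_Dt (haq _ α))]
  have hDxv : ∀ μ α, Dt (Dt (Dx μ (fun r => v r α))) = Dx μ (Dt (Dt (fun r => v r α))) := by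
    intro μ α
    rw [Dt_Dx_comm μ (hvs α), Dt_Dx_comm μ (contDiff_Dt (hvs α))]
  have hbot : ∀ (s : ℝ) (x : Fin 3 → ℝ), x 2 = 0 → η (s, x) 2 = 0 := by
    intro s x hx
    convert hbottom s (x 0) (x 1) using 3
    funext i
    fin_cases i <;> simp [hx]
  have hDxbot : ∀ μ : Fin 3, μ ≠ 2 → ∀ (s : ℝ) (x : Fin 3 → ℝ), x 2 = 0 →
      Dx μ (fun r => η r 2) (s, x) = 0 := fun μ hμ =>
    Dx_eq_zero_of_bottom hμ (hηi 2) hbot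
  have hflux : ∀ y : Fin 2 → ℝ, ∑ α : Fin 3,
      Dt (Dt (fun r => cof η 2 α r * q r)) (t, ![y 0, y 1, 0])
        * Dt (Dt (fun r => v r α)) (t, ![y 0, y 1, 0]) = 0 := by
    intro y
    have hw : Dt (Dt (fun r => v r 2)) (t, ![y 0, y 1, 0]) = 0 := by
      rw [hv' 2]
      exact Dt_eq_zero_of_bottom (Dt_eq_zero_of_bottom (Dt_eq_zero_of_bottom hbot)) t _ rfl
    have hc : ∀ α : Fin 3, α ≠ 2 →
        Dt (Dt (fun r => cof η 2 α r * q r)) (t, ![y 0, y 1, 0]) = 0 := by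
      intro α hα
      refine Dt_eq_zero_of_bottom (Dt_eq_zero_of_bottom fun s x hx => ?_) t _ rfl
      have h0 := hDxbot 0 (by decide) s x hx
      have h1 := hDxbot 1 (by decide) s x hx
      fin_cases α
      · simp [cof, eps, Fin.sum_univ_three, h0, h1]
      · simp [cof, eps, Fin.sum_univ_three, h0, h1]
      · exact absurd rfl hα
    rw [Fin.sum_univ_three, hw, hc 0 (by decide), hc 1 (by decide)]
    simp
  have hFs : ∀ μ, ContDiff ℝ (⊤ : ℕ∞) (fun r => ∑ α : Fin 3,
      Dt (Dt (fun r => cof η μ α r * q r)) r * Dt (Dt (fun r => v r α)) r) := fun μ =>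
    .sum fun α _ => (hGs μ α).mul (hws α)
  have hFper : ∀ (μ : Fin 3) (s : ℝ) (x : Fin 3 → ℝ) (k₁ k₂ : ℤ),
      (fun r => ∑ α : Fin 3, Dt (Dt (fun r => cof η μ α r * q r)) r
        * Dt (Dt (fun r => v r α)) r) (s, x + ![(k₁ : ℝ), (k₂ : ℝ), 0]) =
      (fun r => ∑ α : Fin 3, Dt (Dt (fun r => cof η μ α r * q r)) r
        * Dt (Dt (fun r => v r α)) r) (s, x) := by
    intro μ s x k₁ k₂
    have hηk : ∀ (i : Fin 3) (s : ℝ) (x : Fin 3 → ℝ),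
        η (s, x + ![(k₁ : ℝ), (k₂ : ℝ), 0]) i = η (s, x) i + ![(k₁ : ℝ), (k₂ : ℝ), 0] i :=
      fun i s x => congrFun (hηper s x k₁ k₂) i
    have hDη : ∀ (ν i : Fin 3) (s : ℝ) (x : Fin 3 → ℝ),
        Dx ν (fun r => η r i) (s, x + ![(k₁ : ℝ), (k₂ : ℝ), 0]) = Dx ν (fun r => η r i) (s, x) :=
      fun ν i => Dx_periodic ν (hηk i)
    have hvk : ∀ (i : Fin 3) (s : ℝ) (x : Fin 3 → ℝ),
        v (s, x + ![(k₁ : ℝ), (k₂ : ℝ), 0]) i = v (s, x) i := by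
      intro i s x
      simp only [hv, Dt, hηk, deriv_add_const]
    have hcq : ∀ (α : Fin 3) (s : ℝ) (x : Fin 3 → ℝ),
        (fun r => cof η μ α r * q r) (s, x + ![(k₁ : ℝ), (k₂ : ℝ), 0]) =
          (fun r => cof η μ α r * q r) (s, x) := by
      intro α s x
      simp only [cof, hDη, hqper]
    exact Finset.sum_congr rfl fun α _ => congrArg₂ (· * ·)
      (Dt_periodic (Dt_periodic (hcq α)) s x) (Dt_periodic (Dt_periodic (hvk α)) s x)
  have hbottom_zero : (∫ y in Set.Icc (0 : Fin 2 → ℝ) 1, ∑ α : Fin 3,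
      Dt (Dt (fun r => cof η 2 α r * q r)) (t, ![y 0, y 1, 0])
        * Dt (Dt (fun r => v r α)) (t, ![y 0, y 1, 0])) = 0 := by
    simp only [hflux, integral_zero]
  refine ⟨?_, hbottom_zero⟩
  have hE : ContDiff ℝ (⊤ : ℕ∞) (fun r => ∑ α : Fin 3, (Dt (Dt (fun r => v r α)) r) ^ 2) :=
    .sum fun α _ => (hws α).pow 2
  have hDtE : ∀ x, (1 / 2 : ℝ) *
      Dt (fun r => ∑ α : Fin 3, (Dt (Dt (fun r => v r α)) r) ^ 2) (t, x) =
      (∑ μ : Fin 3, ∑ α : Fin 3, Dt (Dt (fun r => cof η μ α r * q r)) (t, x)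
        * Dt (Dt (Dx μ (fun r => v r α))) (t, x))
      - ∑ μ : Fin 3, Dx μ (fun r => ∑ α : Fin 3,
          Dt (Dt (fun r => cof η μ α r * q r)) r * Dt (Dt (fun r => v r α)) r) (t, x) := by
    intro x
    rw [half_Dt_sum_sq hws hGs (fun α p => congrFun (hdiv3 α) p)]
    simp only [hDxv]
  refine ((hasDerivAt_setIntegral_Icc hE 0 1 t).const_mul (1 / 2 : ℝ)).congr_deriv ?_
  rw [← integral_const_mul]
  simp only [hDtE]
  have hint : ∀ {h : (Fin 3 → ℝ) → ℝ}, Continuous h → IntegrableOn h (Set.Icc 0 1) := fun hh =>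
    hh.continuousOn.integrableOn_compact isCompact_Icc
  rw [integral_sub, integral_sum_Dx_of_periodic hFs hFper t, hbottom_zero, sub_zero]
  · refine hint (continuous_finsetSum _ fun μ _ => continuous_finsetSum _ fun α _ => ?_)
    exact ((hGs μ α).continuous.comp (Continuous.prodMk_right t)).mul
      ((contDiff_Dt (contDiff_Dt (contDiff_Dx μ (hvs α)))).continuous.comp
        (Continuous.prodMk_right t))
  · exact hint (continuous_finsetSum _ fun μ _ =>
      (contDiff_Dx μ (hFs μ)).continuous.comp (Continuous.prodMk_right t))
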